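/- Let d ≥ 2, let ω be a (1,d−1)-weight vector, let y = (ξ_1,…,ξ_{d−1}) ∈ M_{1,d−1}(ℝ), and let k ∈ {1,…,d−1}. Assume there exist n_1,…,n_k ∈ {1,…,d−1} such that 1, ξ_{n_1},…,ξ_{n_k} are linearly independent over ℚ. Then {y} is not contained in any proper rational weakly constraining (d−k)-pencil, and L^ω(Λ_y,·) is connected at d−k. In particular, if 1, ξ_1,…,ξ_{d−1} are linearly independent over ℚ, then L^ω(Λ_y,·) is connected at every k ∈ {1,…,d−1}. -/

import Mathlib

open scoped Classical
open MeasureTheory Module Matrix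

noncomputable section

/-- The set of integer vectors in `ℝ^d`. -/
def intVectors (d : ℕ) : Set (Fin d → ℝ) :=
  Set.range fun z : Fin d → ℤ => fun i => (z i : ℝ)

/-- The lattice `g ℤ^d`. -/
def latticeOf {d : ℕ} (g : Matrix (Fin d) (Fin d) ℝ) : Set (Fin d → ℝ) :=
  g.mulVec '' intVectors d

/-- The `i`-th successive minimum of a lattice `Λ ⊆ ℝ^d` with respect to the closed unit
cube (the sup-norm unit ball): the least `r > 0` such that `r C` contains `i` linearly
independent vectors of `Λ`. -/
def succMin (d : ℕ) (Λ : Set (Fin d → ℝ)) (i : ℕ) : ℝ :=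
  sInf {r : ℝ | 0 < r ∧ ∃ v : Fin i → (Fin d → ℝ),
    (∀ j, v j ∈ Λ) ∧ LinearIndependent ℝ v ∧ ∀ j, ‖v j‖ ≤ r}

/-- `ω` is an `(m,n)`-weight vector. -/
def IsWeightVector (m n : ℕ) (ω : Fin (m + n) → ℝ) : Prop :=
  (∀ i, 0 < ω i) ∧
  (∀ i j : Fin (m + n), i ≤ j → (j : ℕ) < m → ω j ≤ ω i) ∧
  (∀ i j : Fin (m + n), m ≤ (i : ℕ) → i ≤ j → ω j ≤ ω i) ∧
  (∑ i ∈ Finset.univ.filter (fun i : Fin (m + n) => (i : ℕ) < m), ω i) = 1 ∧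
  (∑ i ∈ Finset.univ.filter (fun i : Fin (m + n) => m ≤ (i : ℕ)), ω i) = 1

/-- The signed weight: `ω i` for `i < m` (expanding directions) and `-ω i` for `i ≥ m`. -/
def signedWeight (m : ℕ) {d : ℕ} (ω : Fin d → ℝ) (i : Fin d) : ℝ :=
  if (i : ℕ) < m then ω i else -ω i

/-- The diagonal flow `a_t^ω = diag (e^{ω₁ t}, …, e^{ω_m t}, e^{-ω_{m+1} t}, …, e^{-ω_d t})`. -/
def aMat (m : ℕ) {d : ℕ} (ω : Fin d → ℝ) (t : ℝ) : Matrix (Fin d) (Fin d) ℝ :=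
  Matrix.diagonal fun i => Real.exp (signedWeight m ω i * t)

/-- `L_i^ω(Λ, t) = log λ_i (a_t^ω Λ)`. -/
def Lfun (m : ℕ) {d : ℕ} (ω : Fin d → ℝ) (Λ : Set (Fin d → ℝ)) (i : ℕ) (t : ℝ) : ℝ :=
  Real.log (succMin d ((aMat m ω t).mulVec '' Λ) i)

/-- `L^ω(Λ, ⬝)` is connected at `k`: the set `{t ≥ 0 : L_k = L_{k+1}}` is unbounded above. -/
def ConnectedAt (m : ℕ) {d : ℕ} (ω : Fin d → ℝ) (Λ : Set (Fin d → ℝ)) (k : ℕ) : Prop :=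
  ∀ T : ℝ, ∃ t : ℝ, 0 ≤ t ∧ T ≤ t ∧ Lfun m ω Λ k t = Lfun m ω Λ (k + 1) t

/-- `μ_I = ∑_{i ∈ I, i ≤ m} ω_i - ∑_{i ∈ I, i ≥ m+1} ω_i`. -/
def muI (m : ℕ) {d : ℕ} (ω : Fin d → ℝ) (I : Finset (Fin d)) : ℝ :=
  ∑ i ∈ I, signedWeight m ω i

/-- The orthogonal projection `π_I : ℝ^d → ℝ^I`. -/
def coordProj (d : ℕ) (I : Finset (Fin d)) : (Fin d → ℝ) →ₗ[ℝ] (Fin d → ℝ) where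
  toFun v := fun i => if i ∈ I then v i else 0
  map_add' u v := by funext i; by_cases h : i ∈ I <;> simp [h]
  map_smul' c v := by funext i; by_cases h : i ∈ I <;> simp [h]

/-- The coordinate subspace `ℝ^I = span {e_i : i ∈ I}`. -/
def coordSubspace (d : ℕ) (I : Finset (Fin d)) : Submodule ℝ (Fin d → ℝ) :=
  Submodule.span ℝ {v | ∃ i ∈ I, v = Pi.single i (1 : ℝ)}

/-- The coefficient of `e_I` in `w 0 ∧ ⋯ ∧ w (k-1) ∈ ⋀^k ℝ^d`, i.e. the `I`-rows minor
`det (w_{j i})_{j ∈ I, 1 ≤ i ≤ k}`. -/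
def gramCoeff {d k : ℕ} (w : Fin k → Fin d → ℝ) (I : Finset (Fin d)) : ℝ :=
  if h : I.card = k then
    Matrix.det (Matrix.of fun r c : Fin k => w c (I.orderEmbOfFin h r))
  else 0

/-- The minor `det A(I, J)` of a square matrix. -/
def subDet {d : ℕ} (A : Matrix (Fin d) (Fin d) ℝ) (k : ℕ) (I J : Finset (Fin d)) : ℝ :=
  if h : I.card = k ∧ J.card = k then
    Matrix.det (Matrix.of fun r c : Fin k => A (I.orderEmbOfFin h.1 r) (J.orderEmbOfFin h.2 c))
  else 0

/-- The largest eigenvalue of `a_1^ω` appearing in the decomposition of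
`w 0 ∧ ⋯ ∧ w (k-1)` into eigenvectors of `a_1^ω` in `⋀^k ℝ^d`. -/
def largestEigAlong (m : ℕ) {d k : ℕ} (ω : Fin d → ℝ) (w : Fin k → Fin d → ℝ) : ℝ :=
  sSup {r : ℝ | ∃ I : Finset (Fin d), I.card = k ∧ gramCoeff w I ≠ 0 ∧ r = Real.exp (muI m ω I)}

/-- `E_j = span (e_1, …, e_j)` (the first `j` coordinates, 0-indexed internally). -/
def Espan (d : ℕ) (j : ℕ) : Submodule ℝ (Fin d → ℝ) :=
  Submodule.span ℝ {v | ∃ i : Fin d, (i : ℕ) < j ∧ v = Pi.single i (1 : ℝ)}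

/-- `E'_{j+1} = span (e_{j+1}, …, e_m)` (0-indexed: coordinates `≥ j`). -/
def Eprime (m : ℕ) (j : ℕ) : Submodule ℝ (Fin m → ℝ) :=
  Submodule.span ℝ {v | ∃ i : Fin m, j ≤ (i : ℕ) ∧ v = Pi.single i (1 : ℝ)}

/-- `I(W) = {i ∈ {m+1,…,d} : dim (W ∩ E_i) > dim (W ∩ E_{i-1})}`. -/
def Iset (m : ℕ) {d : ℕ} (W : Submodule ℝ (Fin d → ℝ)) : Finset (Fin d) :=
  Finset.univ.filter fun i : Fin d =>
    m ≤ (i : ℕ) ∧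
      finrank ℝ ↥(W ⊓ Espan d (i : ℕ)) < finrank ℝ ↥(W ⊓ Espan d ((i : ℕ) + 1))

/-- `ψ(W) = ∑_{i ∈ I(W)} ω_i`. -/
def psiF (m : ℕ) {d : ℕ} (ω : Fin d → ℝ) (W : Submodule ℝ (Fin d → ℝ)) : ℝ :=
  ∑ i ∈ Iset m W, ω i

/-- `J(W') = {j ∈ {1,…,m} : dim (W' ∩ ⟨e_{j+1},…,e_m⟩) < dim (W' ∩ ⟨e_j,…,e_m⟩)}`. -/
def Jset {m : ℕ} (W' : Submodule ℝ (Fin m → ℝ)) : Finset (Fin m) :=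
  Finset.univ.filter fun j : Fin m =>
    finrank ℝ ↥(W' ⊓ Eprime m ((j : ℕ) + 1)) < finrank ℝ ↥(W' ⊓ Eprime m (j : ℕ))

/-- `φ(W') = ∑_{j ∈ J(W')} ω_j`. -/
def phiF (m n : ℕ) (ω : Fin (m + n) → ℝ) (W' : Submodule ℝ (Fin m → ℝ)) : ℝ :=
  ∑ j ∈ Jset W', ω (Fin.castAdd n j)

/-- `u(x) = [[Iₘ, x], [0, Iₙ]]`. -/
def uMat (m n : ℕ) (x : Matrix (Fin m) (Fin n) ℝ) : Matrix (Fin (m + n)) (Fin (m + n)) ℝ :=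
  Matrix.reindex finSumFinEquiv finSumFinEquiv (Matrix.fromBlocks 1 x 0 1)

/-- `x̃ ∈ M_{m,d}(ℝ)`: the first `m` rows of `u(x)`. -/
def xTil (m n : ℕ) (x : Matrix (Fin m) (Fin n) ℝ) : Matrix (Fin m) (Fin (m + n)) ℝ :=
  Matrix.of fun i j => uMat m n x (Fin.castAdd n i) j

/-- `ker x̃` as a subspace of `ℝ^d`. -/
def kerXtil (m n : ℕ) (x : Matrix (Fin m) (Fin n) ℝ) : Submodule ℝ (Fin (m + n) → ℝ) :=
  LinearMap.ker (xTil m n x).mulVecLin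

/-- The `k`-pencil `P^ω_{W,a,b} = {x : ψ(ker x̃ ∩ W) ≥ a ∧ φ(x̃ W) ≤ b}`. -/
def pencil (m n : ℕ) (ω : Fin (m + n) → ℝ) (W : Submodule ℝ (Fin (m + n) → ℝ)) (a b : ℝ) :
    Set (Matrix (Fin m) (Fin n) ℝ) :=
  {x | a ≤ psiF m ω (kerXtil m n x ⊓ W) ∧ phiF m n ω (W.map (xTil m n x).mulVecLin) ≤ b}

/-- A subspace of `ℝ^d` is rational (defined over `ℚ`) if it is spanned by rational vectors. -/
def IsRationalSubspace {d : ℕ} (W : Submodule ℝ (Fin d → ℝ)) : Prop :=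
  ∃ S : Set (Fin d → ℚ),
    Submodule.span ℝ ((fun q : Fin d → ℚ => fun i => ((q i : ℝ))) '' S) = W

/-- A subset of `M_{m,n}(ℝ)` is Zariski closed if it is the common zero locus of a set of
real polynomials in the matrix entries. -/
def IsZariskiClosed {m n : ℕ} (S : Set (Matrix (Fin m) (Fin n) ℝ)) : Prop :=
  ∃ P : Set (MvPolynomial (Fin m × Fin n) ℝ),
    S = {x | ∀ p ∈ P, MvPolynomial.eval (fun ij => x ij.1 ij.2) p = 0}

/-- View a point of Euclidean space indexed by matrix entries as a matrix. -/
def matOfEuc (m n : ℕ) (z : EuclideanSpace ℝ (Fin m × Fin n)) : Matrix (Fin m) (Fin n) ℝ :=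
  Matrix.of fun i j => z (i, j)

/-- `M` is a `p`-dimensional analytic submanifold: around every point, `M` agrees with the
image of an injective analytic immersion of an open subset of `ℝ^p`. -/
def IsAnalyticSubmanifold {ι : Type*} [Fintype ι] (p : ℕ) (M : Set (EuclideanSpace ℝ ι)) :
    Prop :=
  ∀ z ∈ M, ∃ (U : Set (EuclideanSpace ℝ (Fin p)))
      (f : EuclideanSpace ℝ (Fin p) → EuclideanSpace ℝ ι) (V : Set (EuclideanSpace ℝ ι)),
    IsOpen U ∧ IsOpen V ∧ z ∈ V ∧ AnalyticOnNhd ℝ f U ∧ Set.InjOn f U ∧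
      (∀ u ∈ U, Function.Injective (fderiv ℝ f u)) ∧ f '' U = M ∩ V

/-- A column matrix from a vector. -/
def colMat (m : ℕ) (ξ : Fin m → ℝ) : Matrix (Fin m) (Fin 1) ℝ :=
  Matrix.of fun i _ => ξ i

/-- A row matrix from a vector. -/
def rowMat (n : ℕ) (ξ : Fin n → ℝ) : Matrix (Fin 1) (Fin n) ℝ :=
  Matrix.of fun _ j => ξ j

/-- The minor of `x` with rows `P` and columns `Q`. -/
def minorDet (m n : ℕ) (x : Matrix (Fin m) (Fin n) ℝ) (P : Finset (Fin m))
    (Q : Finset (Fin n)) (h : P.card = Q.card) : ℝ :=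
  Matrix.det (Matrix.of fun r c : Fin P.card =>
    x (P.orderEmbOfFin rfl r) (Q.orderEmbOfFin h.symm c))

/-- `𝓓(𝓡)`: the set of all `p × p` minors of `x` with increasing rows in `{1,…,m}` and
increasing columns in `𝓡`, for `1 ≤ p ≤ min m (d - k)`. -/
def Dset (m n k : ℕ) (x : Matrix (Fin m) (Fin n) ℝ) (R : Finset (Fin n)) : Set ℝ :=
  {r | ∃ (P : Finset (Fin m)) (Q : Finset (Fin n)) (h : P.card = Q.card),
    Q ⊆ R ∧ 1 ≤ P.card ∧ P.card ≤ min m (m + n - k) ∧ r = minorDet m n x P Q h}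


/-- Minkowski's first theorem for `ℤ^d` and a parallelepiped `{x : ‖B x‖ < r}`. -/
lemma exists_int_norm_mulVec_lt {d : ℕ} (B : Matrix (Fin d) (Fin d) ℝ) (hB : B.det ≠ 0)
    {r : ℝ} (hr : 0 < r) (h : |B.det| < r ^ d) :
    ∃ z ∈ intVectors d, z ≠ 0 ∧ ‖B *ᵥ z‖ < r := by
  have hdet : LinearMap.det (Matrix.toLin' B) ≠ 0 := by rwa [LinearMap.det_toLin']
  have hF := (ZSpan.isAddFundamentalDomain' (Pi.basisFun ℝ (Fin d)) volume)
  have hvol : volume (ZSpan.fundamentalDomain (Pi.basisFun ℝ (Fin d))) = 1 := by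
    rw [ZSpan.fundamentalDomain_pi_basisFun, volume_pi_pi]
    simp
  have : Countable (Submodule.span ℤ (Set.range (Pi.basisFun ℝ (Fin d)))).toAddSubgroup :=
    inferInstanceAs (Countable (Submodule.span ℤ (Set.range (Pi.basisFun ℝ (Fin d)))))
  obtain ⟨⟨x, hx⟩, hx0, hxs⟩ := exists_ne_zero_mem_lattice_of_measure_mul_two_pow_lt_measure
    (s := (Matrix.toLin' B) ⁻¹' Metric.ball 0 r) hF
    (fun x hx => by simpa [Matrix.mulVec_neg] using hx)
    ((convex_ball (0 : Fin d → ℝ) r).linear_preimage (Matrix.toLin' B)) (by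
      rw [hvol, one_mul, Measure.addHaar_preimage_linearMap _ hdet, Real.volume_pi_ball _ hr,
        LinearMap.det_toLin', ← ENNReal.ofReal_mul (abs_nonneg _), finrank_fin_fun]
      have : (2 : ENNReal) ^ d = ENNReal.ofReal (2 ^ d) := by
        rw [ENNReal.ofReal_pow (by norm_num)]; simp
      rw [this, Fintype.card_fin]
      apply (ENNReal.ofReal_lt_ofReal_iff_of_nonneg (by positivity)).2
      rw [mul_pow, abs_inv, mul_left_comm, ← div_eq_inv_mul]
      have hpos : 0 < |B.det| := abs_pos.2 hB
      have : 1 < r ^ d / |B.det| := (one_lt_div hpos).2 h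
      exact lt_mul_of_one_lt_right (by positivity) this)
  refine ⟨x, ?_, fun h => hx0 (Subtype.ext h), by simpa using hxs⟩
  have hx' : x ∈ Submodule.span ℤ (Set.range (Pi.basisFun ℝ (Fin d))) := hx
  rw [Basis.mem_span_iff_repr_mem] at hx'
  choose z hz using hx'
  exact ⟨z, funext fun i => by simpa using hz i⟩

/-- QR decomposition. -/
lemma exists_orthogonal_triangular {d : ℕ} (v : Fin d → Fin d → ℝ) :
    ∃ Q : Matrix (Fin d) (Fin d) ℝ, Qᵀ * Q = 1 ∧ ∀ i j, i < j → (Q *ᵥ v i) j = 0 := by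
  let w : Fin d → EuclideanSpace ℝ (Fin d) := fun i => WithLp.toLp 2 (v i)
  let b := InnerProductSpace.gramSchmidtOrthonormalBasis (𝕜 := ℝ) (by simp) w
  refine ⟨Matrix.of fun i j => b i j, ?_, fun i j hij => ?_⟩
  · rw [mul_eq_one_comm]
    ext i j
    have := orthonormal_iff_ite.1 b.orthonormal i j
    rw [Matrix.one_apply, ← this, PiLp.inner_apply, Matrix.mul_apply]
    exact Finset.sum_congr rfl fun k _ => by simp [mul_comm]
  · have := InnerProductSpace.gramSchmidtOrthonormalBasis_inv_triangular (𝕜 := ℝ)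
      (by simp) w hij
    rw [PiLp.inner_apply] at this
    rw [← this]
    change ∑ k, b j k * v i k = _
    exact Finset.sum_congr rfl fun k _ => mul_comm (b j k) (w i k)

lemma abs_entry_le_one {d : ℕ} {Q : Matrix (Fin d) (Fin d) ℝ} (hQ : Qᵀ * Q = 1) (i j : Fin d) :
    |Q i j| ≤ 1 := by
  have h : ∑ k, Q k j * Q k j = 1 := by
    have := congrFun (congrFun hQ j) j
    simpa [Matrix.mul_apply] using this
  rw [← sq_le_one_iff_abs_le_one, sq, ← h]
  exact Finset.single_le_sum (f := fun k => Q k j * Q k j) (fun k _ => mul_self_nonneg _)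
    (Finset.mem_univ i)

/-- The upper bound of Minkowski's second theorem. -/
lemma prod_norm_le_of_minimal {d : ℕ} (hd : 0 < d) (g : Matrix (Fin d) (Fin d) ℝ)
    (hg : |g.det| = 1) (v : Fin d → Fin d → ℝ) (hv : LinearIndependent ℝ v)
    (hmin : ∀ j, ∀ z ∈ intVectors d, z ∉ Submodule.span ℝ (v '' Set.Iio j) →
      ‖g *ᵥ v j‖ ≤ ‖g *ᵥ z‖) (hmem : ∀ j, v j ∈ intVectors d) :
    ∏ j, ‖g *ᵥ v j‖ ≤ (d : ℝ) ^ d := by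
  have hdet : g.det ≠ 0 := fun h => by simp [h] at hg
  have hinj : Function.Injective g.mulVec :=
    Matrix.mulVec_injective_of_isUnit ((Matrix.isUnit_iff_isUnit_det g).2 hdet.isUnit)
  have hpos : ∀ j, 0 < ‖g *ᵥ v j‖ := fun j => norm_pos_iff.2 fun h =>
    hv.ne_zero j (hinj (by rw [h, Matrix.mulVec_zero]))
  have hmono : ∀ i j, i ≤ j → ‖g *ᵥ v i‖ ≤ ‖g *ᵥ v j‖ := fun i j hij =>
    hmin i _ (hmem j) (hv.notMem_span_image (by simpa using hij))
  obtain ⟨Q, hQ, hT⟩ := exists_orthogonal_triangular fun i => g *ᵥ v i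
  have hdetQ : |Q.det| = 1 := by
    have := congrArg Matrix.det hQ
    rw [Matrix.det_mul, Matrix.det_transpose, Matrix.det_one, ← abs_mul_abs_self] at this
    nlinarith [abs_nonneg Q.det]
  set B : Matrix (Fin d) (Fin d) ℝ :=
    Matrix.diagonal (fun i => ‖g *ᵥ v i‖⁻¹) * (Q * g) with hBdef
  have hdetB : |B.det| = (∏ j, ‖g *ᵥ v j‖)⁻¹ := by
    rw [hBdef, Matrix.det_mul, Matrix.det_mul, Matrix.det_diagonal, abs_mul, abs_mul, hg, hdetQ,
      Finset.prod_inv_distrib, abs_inv, abs_of_pos (Finset.prod_pos fun j _ => hpos j)]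
    ring
  have hP : 0 < ∏ j, ‖g *ᵥ v j‖ := Finset.prod_pos fun j _ => hpos j
  have hd' : (0 : ℝ) < d := by exact_mod_cast hd
  by_contra! hlt
  obtain ⟨z, hz, hz0, hzB⟩ := exists_int_norm_mulVec_lt B
    (by rw [← abs_pos, hdetB]; positivity) (r := (d : ℝ)⁻¹) (by positivity)
    (by rw [hdetB, inv_pow]; exact inv_strictAnti₀ (by positivity) hlt)
  have : Nonempty (Fin d) := ⟨⟨0, hd⟩⟩
  let b := basisOfLinearIndependentOfCardEqFinrank hv (by simp)
  have hb : ⇑b = v := coe_basisOfLinearIndependentOfCardEqFinrank hv (by simp)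
  have hne : (b.repr z).support.Nonempty := by
    rw [Finsupp.support_nonempty_iff]
    simpa using hz0
  set j := (b.repr z).support.max' hne with hj
  have hle : ∀ i, j < i → b.repr z i = 0 := fun i hi => by
    by_contra h
    exact absurd ((b.repr z).support.le_max' i (Finsupp.mem_support_iff.2 h)) (not_le.2 hi)
  have hnot : z ∉ Submodule.span ℝ (v '' Set.Iio j) := by
    rw [← hb, b.mem_span_image]
    intro h
    exact absurd (h ((b.repr z).support.max'_mem hne)) (by simp [← hj])
  have hsum : g *ᵥ z = ∑ i, b.repr z i • g *ᵥ v i := by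
    conv_lhs => rw [← b.sum_repr z, hb]
    simp [Matrix.mulVec_sum, Matrix.mulVec_smul]
  have hcoord : ∀ i, |(Q *ᵥ (g *ᵥ z)) i| < ‖g *ᵥ v j‖ / d := by
    intro i
    rcases lt_or_ge j i with hi | hi
    · have : (Q *ᵥ (g *ᵥ z)) i = 0 := by
        rw [hsum, Matrix.mulVec_sum, Finset.sum_apply]
        refine Finset.sum_eq_zero fun l _ => ?_
        rcases lt_or_ge j l with hl | hl
        · simp [hle l hl]
        · rw [Matrix.mulVec_smul, Pi.smul_apply, hT l i (hl.trans_lt hi), smul_zero]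
      rw [this, abs_zero]
      exact div_pos (hpos j) hd'
    · have h1 : |(B *ᵥ z) i| < (d : ℝ)⁻¹ := (norm_le_pi_norm (B *ᵥ z) i).trans_lt hzB
      have h2 : (B *ᵥ z) i = ‖g *ᵥ v i‖⁻¹ * (Q *ᵥ (g *ᵥ z)) i := by
        rw [hBdef, ← Matrix.mulVec_mulVec, Matrix.mulVec_diagonal, Matrix.mulVec_mulVec]
      rw [h2, abs_mul, abs_inv, abs_norm, inv_mul_lt_iff₀ (hpos i)] at h1
      refine h1.trans_le ?_
      rw [← div_eq_mul_inv]
      exact div_le_div_of_nonneg_right (hmono i j hi) hd'.le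
  have hlt' : ‖g *ᵥ z‖ < ‖g *ᵥ v j‖ := by
    rw [pi_norm_lt_iff (hpos j)]
    intro l
    have h1 : g *ᵥ z = Qᵀ *ᵥ (Q *ᵥ (g *ᵥ z)) := by
      rw [Matrix.mulVec_mulVec _ Qᵀ, hQ, Matrix.one_mulVec]
    rw [h1, Real.norm_eq_abs]
    calc |(Qᵀ *ᵥ (Q *ᵥ (g *ᵥ z))) l| = |∑ i, Q i l * (Q *ᵥ (g *ᵥ z)) i| := rfl
      _ ≤ ∑ i, |Q i l * (Q *ᵥ (g *ᵥ z)) i| := Finset.abs_sum_le_sum_abs _ _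
      _ ≤ ∑ i, |(Q *ᵥ (g *ᵥ z)) i| := Finset.sum_le_sum fun i _ => by
          rw [abs_mul]
          exact mul_le_of_le_one_left (abs_nonneg _) (abs_entry_le_one hQ i l)
      _ < ∑ _i : Fin d, ‖g *ᵥ v j‖ / d :=
          Finset.sum_lt_sum_of_nonempty Finset.univ_nonempty fun i _ => hcoord i
      _ = ‖g *ᵥ v j‖ := by simp; field_simp
  exact absurd (hmin j z hz hnot) (not_le.2 hlt')

/-- Every lattice `g ℤ^d` admits vectors successively minimising the norm outside the span of
their predecessors. -/
lemma exists_minimal_family {d : ℕ} (g : Matrix (Fin d) (Fin d) ℝ) (hg : g.det ≠ 0) :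
    ∃ v : Fin d → Fin d → ℝ, LinearIndependent ℝ v ∧ (∀ j, v j ∈ intVectors d) ∧
      ∀ j, ∀ z ∈ intVectors d, z ∉ Submodule.span ℝ (v '' Set.Iio j) →
        ‖g *ᵥ v j‖ ≤ ‖g *ᵥ z‖ := by
  have hunit : IsUnit g := (Matrix.isUnit_iff_isUnit_det g).2 hg.isUnit
  have hcast : Topology.IsClosedEmbedding (fun (z : Fin d → ℤ) (i : Fin d) => (z i : ℝ)) :=
    Topology.IsClosedEmbedding.piMap fun _ => Int.isClosedEmbedding_coe_real
  have hglin : Topology.IsClosedEmbedding g.mulVec :=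
    (Matrix.toLin' g).isClosedEmbedding_of_injective
      (LinearMap.ker_eq_bot.2 (Matrix.mulVec_injective_of_isUnit hunit))
  have htend : Filter.Tendsto (fun z : Fin d → ℤ => ‖g *ᵥ (fun i => (z i : ℝ))‖)
      Filter.cofinite Filter.atTop := by
    rw [← Filter.cocompact_eq_cofinite]
    exact (tendsto_norm_cocompact_atTop (E := Fin d → ℝ)).comp
      (hglin.comp hcast).tendsto_cocompact
  have hsel : ∀ S : Submodule ℝ (Fin d → ℝ), S ≠ ⊤ → ∃ x ∈ intVectors d, x ∉ S ∧
      ∀ z ∈ intVectors d, z ∉ S → ‖g *ᵥ x‖ ≤ ‖g *ᵥ z‖ := by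
    intro S hS
    have hne : {z : Fin d → ℤ | (fun i => (z i : ℝ)) ∉ S}.Nonempty := by
      by_contra h
      rw [Set.not_nonempty_iff_eq_empty, Set.eq_empty_iff_forall_notMem] at h
      refine hS (eq_top_iff.2 ?_)
      rw [← (Pi.basisFun ℝ (Fin d)).span_eq, Submodule.span_le]
      rintro _ ⟨i, rfl⟩
      have := not_not.1 (h (Pi.single i 1))
      suffices hsingle : Pi.basisFun ℝ (Fin d) i = fun l => ((Pi.single i 1 : Fin d → ℤ) l : ℝ) by
        rwa [hsingle]
      ext l
      by_cases hl : l = i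
      · subst hl; simp
      · simp [hl]
    obtain ⟨z, hz, hz'⟩ := Filter.Tendsto.exists_within_forall_le hne htend
    refine ⟨_, ⟨z, rfl⟩, hz, ?_⟩
    rintro _ ⟨y, rfl⟩ hy
    exact hz' y hy
  have key : ∀ m, m ≤ d → ∃ v : Fin m → Fin d → ℝ, LinearIndependent ℝ v ∧
      (∀ j, v j ∈ intVectors d) ∧
      ∀ j, ∀ z ∈ intVectors d, z ∉ Submodule.span ℝ (v '' Set.Iio j) →
        ‖g *ᵥ v j‖ ≤ ‖g *ᵥ z‖ := by
    intro m
    induction m with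
    | zero => exact fun _ => ⟨Fin.elim0, linearIndependent_empty_type, fun j => j.elim0,
        fun j => j.elim0⟩
    | succ m ih =>
      intro hm
      obtain ⟨v, hv, hint, hmin⟩ := ih (by omega)
      obtain ⟨x, hx, hxS, hxmin⟩ := hsel (Submodule.span ℝ (Set.range v)) fun h => by
        have h1 := finrank_span_eq_card hv
        rw [h, finrank_top] at h1
        simp at h1
        omega
      have himg : ∀ j : Fin m,
          (Fin.snoc v x : Fin (m + 1) → Fin d → ℝ) '' Set.Iio j.castSucc = v '' Set.Iio j := by
        intro j
        ext y
        constructor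
        · rintro ⟨i, hi, rfl⟩
          have him : (i : ℕ) < m := lt_trans (Fin.lt_def.1 hi) j.isLt
          refine ⟨⟨i, him⟩, hi, ?_⟩
          simp [Fin.snoc, him]
          rfl
        · rintro ⟨i, hi, rfl⟩
          exact ⟨i.castSucc, by simpa using hi, by simp⟩
      have hlast : (Fin.snoc v x : Fin (m + 1) → Fin d → ℝ) '' Set.Iio (Fin.last m)
          = Set.range v := by
        ext y
        constructor
        · rintro ⟨i, hi, rfl⟩
          have him : (i : ℕ) < m := hi
          refine ⟨⟨i, him⟩, ?_⟩
          simp [Fin.snoc, him]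
          rfl
        · rintro ⟨i, rfl⟩
          exact ⟨i.castSucc, by simp, by simp⟩
      refine ⟨Fin.snoc v x, linearIndependent_finSnoc.2 ⟨hv, hxS⟩, fun j => ?_, fun j => ?_⟩
      · refine Fin.lastCases ?_ (fun j => ?_) j
        · simpa using hx
        · simpa using hint j
      · refine Fin.lastCases ?_ (fun j => ?_) j
        · rw [hlast]; simpa using hxmin
        · rw [himg]; simpa using hmin j
  exact key d le_rfl

lemma exists_det_dual_eq_mul_basis_det {ι M : Type*} [Fintype ι] [DecidableEq ι] [AddCommGroup M]
    [Module ℝ M] (p : Basis ι ℝ M) (φ : ι → Dual ℝ M) (hφ : LinearIndependent ℝ φ) :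
    ∃ κ : ℝ, κ ≠ 0 ∧ ∀ v : ι → M,
      (Matrix.of fun a b => φ a (v b)).det = κ * p.det v := by
  refine ⟨(Matrix.of fun a c => φ a (p c)).det, ?_, fun v => ?_⟩
  · rw [← isUnit_iff_ne_zero, ← Matrix.isUnit_iff_isUnit_det,
      ← Matrix.linearIndependent_rows_iff_isUnit]
    let T : Dual ℝ M →ₗ[ℝ] (ι → ℝ) := LinearMap.pi fun c => LinearMap.applyₗ (p c)
    have hT : LinearMap.ker T = ⊥ := LinearMap.ker_eq_bot'.2 fun f hf =>
      p.ext fun c => by simpa [T] using congrFun hf c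
    exact hφ.map' T hT
  · rw [Basis.det_apply, ← Matrix.det_mul]
    congr 1
    ext a b
    rw [Matrix.mul_apply, Matrix.of_apply]
    conv_lhs => rw [← p.sum_repr (v b), map_sum]
    exact Finset.sum_congr rfl fun c _ => by simp [Basis.toMatrix_apply, mul_comm]

/-- The `i`-th coordinate of `U x`, as a functional on a subspace. -/
def rowDual {d : ℕ} (U : Matrix (Fin d) (Fin d) ℝ) (W : Submodule ℝ (Fin d → ℝ)) (i : Fin d) :
    Dual ℝ W :=
  (LinearMap.proj i ∘ₗ U.mulVecLin) ∘ₗ W.subtype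

lemma rowDual_apply {d : ℕ} (U : Matrix (Fin d) (Fin d) ℝ) (W : Submodule ℝ (Fin d → ℝ))
    (i : Fin d) (w : W) : rowDual U W i w = (U *ᵥ (w : Fin d → ℝ)) i := rfl

lemma span_range_rowDual {d : ℕ} {U : Matrix (Fin d) (Fin d) ℝ} (hU : IsUnit U)
    (W : Submodule ℝ (Fin d → ℝ)) : Submodule.span ℝ (Set.range (rowDual U W)) = ⊤ := by
  rw [eq_top_iff]
  intro f _
  obtain ⟨g, hg⟩ := LinearMap.exists_extend f
  have hUdet : IsUnit U.det := (Matrix.isUnit_iff_isUnit_det U).1 hU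
  have hf : f = ∑ i, g (U⁻¹ *ᵥ Pi.single i 1) • rowDual U W i := by
    ext w
    have h1 : f w = (g ∘ₗ U⁻¹.mulVecLin) (U *ᵥ (w : Fin d → ℝ)) := by
      simp [← hg, Matrix.mulVec_mulVec, Matrix.nonsing_inv_mul U hUdet]
    rw [h1, LinearMap.pi_apply_eq_sum_univ]
    simp only [LinearMap.sum_apply, LinearMap.smul_apply, rowDual_apply, LinearMap.comp_apply,
      Matrix.mulVecLin_apply, smul_eq_mul]
    refine Finset.sum_congr rfl fun i _ => ?_
    rw [mul_comm]
    congr 3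
    ext j
    simp [Pi.single_apply, eq_comm]
  rw [hf]
  exact Submodule.sum_mem _ fun i _ =>
    Submodule.smul_mem _ _ (Submodule.subset_span ⟨i, rfl⟩)

lemma exists_linearIndependent_rowDual {d : ℕ} {U : Matrix (Fin d) (Fin d) ℝ} (hU : IsUnit U)
    (W : Submodule ℝ (Fin d → ℝ)) (i₀ : Fin d) (h : ∃ w ∈ W, (U *ᵥ w) i₀ ≠ 0) :
    ∃ e : Fin (finrank ℝ W) → Fin d, Function.Injective e ∧ i₀ ∈ Set.range e ∧
      LinearIndependent ℝ (fun a => rowDual U W (e a)) := by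
  obtain ⟨w, hw, hw0⟩ := h
  have h0 : LinearIndepOn ℝ (rowDual U W) {i₀} := by
    refine LinearIndepOn.singleton fun h => hw0 ?_
    rw [← rowDual_apply U W i₀ ⟨w, hw⟩, h]
    rfl
  obtain ⟨b, -, hb, hspan, hind⟩ := exists_linearIndepOn_extension h0 (Set.subset_univ _)
  have htop : Submodule.span ℝ (rowDual U W '' b) = ⊤ := by
    rw [eq_top_iff, ← span_range_rowDual hU W, Submodule.span_le, ← Set.image_univ]
    exact hspan
  have hcard : Fintype.card b = finrank ℝ W := by
    rw [← Subspace.dual_finrank_eq, ← finrank_top ℝ (Dual ℝ W), ← htop, Set.image_eq_range]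
    exact (finrank_span_eq_card hind).symm
  let σ : Fin (finrank ℝ W) ≃ b := (finCongr hcard.symm).trans (Fintype.equivFin b).symm
  refine ⟨fun a => σ a, Subtype.val_injective.comp σ.injective,
    ⟨σ.symm ⟨i₀, hb rfl⟩, by simp⟩, ?_⟩
  exact LinearIndependent.comp hind σ σ.injective

lemma abs_det_le_prod {r : ℕ} (A : Matrix (Fin r) (Fin r) ℝ) (x : Fin r → ℝ)
    (hx : ∀ j, 0 < x j) (hA : ∀ i j, |A i j| ≤ x j) :
    |A.det| ≤ r.factorial * ∏ j, x j := by
  have hA' : A = Matrix.of fun i j => x j * (Matrix.of fun i j => (x j)⁻¹ * A i j) i j := by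
    ext i j
    simp [mul_inv_cancel_left₀ (hx j).ne']
  have h1 : |(Matrix.of fun i j => (x j)⁻¹ * A i j).det| ≤ r.factorial := by
    have := Matrix.det_le (A := Matrix.of fun i j => (x j)⁻¹ * A i j)
      (abv := AbsoluteValue.abs) (x := (1 : ℝ)) fun i j => by
        rw [AbsoluteValue.abs_apply, Matrix.of_apply, abs_mul, abs_inv, abs_of_pos (hx j),
          inv_mul_le_iff₀ (hx j), mul_one]
        exact hA i j
    simpa using this
  rw [hA', Matrix.det_mul_row, abs_mul, abs_of_pos (Finset.prod_pos fun j _ => hx j), mul_comm]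
  exact mul_le_mul_of_nonneg_right h1 (Finset.prod_nonneg fun j _ => (hx j).le)

/-- Lower bound for the product of norms of independent integer vectors in a fixed subspace
under a diagonal flow. -/
lemma exists_le_prod_norm {d : ℕ} {U : Matrix (Fin d) (Fin d) ℝ} (hU : IsUnit U)
    (σ : Fin d → ℝ) (W : Submodule ℝ (Fin d → ℝ)) (i₀ : Fin d) (h : ∃ w ∈ W, (U *ᵥ w) i₀ ≠ 0) :
    ∃ s : Finset (Fin d), i₀ ∈ s ∧ s.card = finrank ℝ W ∧ ∃ c : ℝ, 0 < c ∧
      ∀ (t : ℝ) (v : Fin (finrank ℝ W) → Fin d → ℝ), LinearIndependent ℝ v →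
        (∀ b, v b ∈ W) → (∀ b, v b ∈ intVectors d) →
        c * Real.exp ((∑ i ∈ s, σ i) * t) ≤
          ∏ b, ‖((Matrix.diagonal fun i => Real.exp (σ i * t)) * U) *ᵥ v b‖ := by
  obtain ⟨e, he, hi₀, hlin⟩ := exists_linearIndependent_rowDual hU W i₀ h
  obtain ⟨w, hw, hw0⟩ := h
  have hw' : ∃ j, w j ≠ 0 := by
    by_contra! hzero
    exact hw0 (by rw [show w = 0 from funext hzero, Matrix.mulVec_zero]; rfl)
  obtain ⟨j₀, hj₀⟩ := hw'
  obtain ⟨e', -, -, hlin'⟩ := exists_linearIndependent_rowDual (U := 1) isUnit_one W j₀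
    ⟨w, hw, by simpa using hj₀⟩
  let p := finBasis ℝ W
  obtain ⟨κ, hκ, hdet⟩ := exists_det_dual_eq_mul_basis_det p _ hlin
  obtain ⟨κ', hκ', hdet'⟩ := exists_det_dual_eq_mul_basis_det p _ hlin'
  refine ⟨Finset.univ.map ⟨e, he⟩, by simpa using hi₀, by simp,
    |κ / κ'| / (finrank ℝ W).factorial, by positivity, fun t v hv hvW hvint => ?_⟩
  let v' : Fin (finrank ℝ W) → W := fun b => ⟨v b, hvW b⟩
  have hv' : LinearIndependent ℝ v' := LinearIndependent.of_comp W.subtype hv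
  have hunit : IsUnit (p.det v') := p.is_basis_iff_det.1
    ⟨hv', hv'.span_eq_top_of_card_eq_finrank' (by simp)⟩
  choose z hz using hvint
  have hint : 1 ≤ |κ' * p.det v'| := by
    have h1 : (Matrix.of fun a b => rowDual 1 W (e' a) (v' b)).det
        = ((Matrix.of fun a b => z b (e' a)).det : ℤ) := by
      rw [Int.cast_det]
      congr 1
      ext a b
      simp [rowDual_apply, v', ← hz]
    have h2 : κ' * p.det v' ≠ 0 := mul_ne_zero hκ' hunit.ne_zero
    rw [← hdet', h1] at h2 ⊢
    rw [← Int.cast_abs]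
    exact_mod_cast Int.one_le_abs (by exact_mod_cast h2)
  set G := (Matrix.diagonal fun i => Real.exp (σ i * t)) * U with hG
  have hGunit : IsUnit G := by
    refine IsUnit.mul ?_ hU
    rw [Matrix.isUnit_iff_isUnit_det, Matrix.det_diagonal]
    exact (Finset.prod_pos fun i _ => Real.exp_pos _).ne'.isUnit
  have hpos : ∀ b, 0 < ‖G *ᵥ v b‖ := fun b => norm_pos_iff.2 fun h =>
    hv.ne_zero b (Matrix.mulVec_injective_of_isUnit hGunit (by rw [h, Matrix.mulVec_zero]))
  have hentry : ∀ x i, (G *ᵥ x) i = Real.exp (σ i * t) * (U *ᵥ x) i := fun x i => by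
    rw [hG, ← Matrix.mulVec_mulVec, Matrix.mulVec_diagonal]
  have hupper := abs_det_le_prod (Matrix.of fun a b => (G *ᵥ v b) (e a)) (fun b => ‖G *ᵥ v b‖)
    hpos fun a b => norm_le_pi_norm (G *ᵥ v b) (e a)
  have hGdet : (Matrix.of fun a b => (G *ᵥ v b) (e a)).det
      = Real.exp ((∑ a, σ (e a)) * t) * (κ * p.det v') := by
    rw [← hdet, Finset.sum_mul, Real.exp_sum, ← Matrix.det_mul_column]
    congr 1
    ext a b
    simp [hentry, rowDual_apply, v']
  rw [hGdet, abs_mul, Real.abs_exp] at hupper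
  have hκle : |κ / κ'| ≤ |κ * p.det v'| := by
    have h3 : κ * p.det v' = κ / κ' * (κ' * p.det v') := by field_simp
    rw [h3, abs_mul]
    exact le_mul_of_one_le_right (abs_nonneg _) hint
  rw [Finset.sum_map, div_mul_eq_mul_div, div_le_iff₀ (by positivity), mul_comm |κ / κ'|,
    mul_comm _ ((finrank ℝ W).factorial : ℝ)]
  exact (mul_le_mul_of_nonneg_left hκle (Real.exp_pos _).le).trans hupper

section succMin

variable {d : ℕ} {g : Matrix (Fin d) (Fin d) ℝ}

lemma bddBelow_succMin_set (Λ : Set (Fin d → ℝ)) (i : ℕ) :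
    BddBelow {r : ℝ | 0 < r ∧ ∃ v : Fin i → (Fin d → ℝ),
      (∀ j, v j ∈ Λ) ∧ LinearIndependent ℝ v ∧ ∀ j, ‖v j‖ ≤ r} :=
  ⟨0, fun _ hr => hr.1.le⟩

lemma nonempty_succMin_set (hg : IsUnit g) {i : ℕ} (hi : i ≤ d) :
    {r : ℝ | 0 < r ∧ ∃ v : Fin i → (Fin d → ℝ),
      (∀ j, v j ∈ g.mulVec '' intVectors d) ∧ LinearIndependent ℝ v ∧
        ∀ j, ‖v j‖ ≤ r}.Nonempty := by
  obtain ⟨v, hv, hint, -⟩ :=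
    exists_minimal_family g ((Matrix.isUnit_iff_isUnit_det g).1 hg).ne_zero
  have hker : LinearMap.ker g.mulVecLin = ⊥ :=
    LinearMap.ker_eq_bot.2 (Matrix.mulVec_injective_of_isUnit hg)
  refine ⟨1 + ∑ j, ‖g *ᵥ v (Fin.castLE hi j)‖, by positivity,
    fun j => g *ᵥ v (Fin.castLE hi j), fun j => ⟨_, hint _, rfl⟩,
    (hv.map' _ hker).comp _ (Fin.castLE_injective hi), fun j => ?_⟩
  have := Finset.single_le_sum (f := fun j => ‖g *ᵥ v (Fin.castLE hi j)‖)
    (fun _ _ => norm_nonneg _) (Finset.mem_univ j)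
  linarith

lemma succMin_le_succ (hg : IsUnit g) {i : ℕ} (hi : i + 1 ≤ d) :
    succMin d (g.mulVec '' intVectors d) i ≤ succMin d (g.mulVec '' intVectors d) (i + 1) := by
  refine csInf_le_csInf (bddBelow_succMin_set _ _) (nonempty_succMin_set hg hi) ?_
  rintro r ⟨hr, v, hv, hlin, hle⟩
  exact ⟨hr, v ∘ Fin.castSucc, fun j => hv _, hlin.comp _ (Fin.castSucc_injective i),
    fun j => hle _⟩

lemma succMin_lt_of_forall_norm_lt (hg : IsUnit g) {i : ℕ} {z : Fin (i + 1) → Fin d → ℝ}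
    (hz : ∀ j, z j ∈ intVectors d) (hlin : LinearIndependent ℝ z) {R : ℝ}
    (hR : ∀ j, ‖g *ᵥ z j‖ < R) : succMin d (g.mulVec '' intVectors d) (i + 1) < R := by
  have hker : LinearMap.ker g.mulVecLin = ⊥ :=
    LinearMap.ker_eq_bot.2 (Matrix.mulVec_injective_of_isUnit hg)
  have hlin' := hlin.map' _ hker
  obtain ⟨j, hj⟩ := Finite.exists_max fun j => ‖g *ᵥ z j‖
  refine lt_of_le_of_lt (csInf_le (bddBelow_succMin_set _ _) ?_) (hR j)
  exact ⟨norm_pos_iff.2 (hlin'.ne_zero j), fun j => g *ᵥ z j,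
    fun j => ⟨z j, hz j, rfl⟩, hlin', hj⟩

lemma exists_norm_lt_of_succMin_lt (hg : IsUnit g) {i : ℕ} (hi : i ≤ d) {R : ℝ}
    (hR : succMin d (g.mulVec '' intVectors d) i < R) :
    ∃ z : Fin i → Fin d → ℝ, (∀ j, z j ∈ intVectors d) ∧ LinearIndependent ℝ z ∧
      ∀ j, ‖g *ᵥ z j‖ < R := by
  obtain ⟨r, ⟨-, v, hv, hlin, hle⟩, hr⟩ := exists_lt_of_csInf_lt (nonempty_succMin_set hg hi) hR
  choose z hz hzv using hv
  obtain rfl : (fun j => g *ᵥ z j) = v := funext hzv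
  exact ⟨z, hz, LinearIndependent.of_comp g.mulVecLin hlin, fun j => (hle j).trans_lt hr⟩

lemma succMin_le_mul {h : Matrix (Fin d) (Fin d) ℝ} (hg : IsUnit g) (hh : IsUnit h) {C : ℝ}
    (hC : 0 < C) (hgh : ∀ x, ‖g *ᵥ x‖ ≤ C * ‖h *ᵥ x‖) {i : ℕ} (hi : i ≤ d) :
    succMin d (g.mulVec '' intVectors d) i ≤ C * succMin d (h.mulVec '' intVectors d) i := by
  have hker : LinearMap.ker g.mulVecLin = ⊥ :=
    LinearMap.ker_eq_bot.2 (Matrix.mulVec_injective_of_isUnit hg)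
  rw [← div_le_iff₀' hC]
  refine le_csInf (nonempty_succMin_set hh hi) ?_
  rintro r ⟨hr, v, hv, hlin, hle⟩
  rw [div_le_iff₀' hC]
  choose z hz hzv using hv
  obtain rfl : (fun j => h *ᵥ z j) = v := funext hzv
  have hlin' : LinearIndependent ℝ z := LinearIndependent.of_comp h.mulVecLin hlin
  exact csInf_le (bddBelow_succMin_set _ _) ⟨by positivity, fun j => g *ᵥ z j,
    fun j => ⟨z j, hz j, rfl⟩, hlin'.map' _ hker,
    fun j => (hgh _).trans (mul_le_mul_of_nonneg_left (hle j) hC.le)⟩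

end succMin

/-- The span of the integer vectors `z` with `g z` shorter than the `i`-th minimum of `g ℤ^d`. -/
def shortSpan {d : ℕ} (g : Matrix (Fin d) (Fin d) ℝ) (i : ℕ) : Submodule ℝ (Fin d → ℝ) :=
  Submodule.span ℝ
    {z | z ∈ intVectors d ∧ ‖g *ᵥ z‖ < succMin d (g.mulVec '' intVectors d) i}

lemma isRationalSubspace_shortSpan {d : ℕ} (g : Matrix (Fin d) (Fin d) ℝ) (i : ℕ) :
    IsRationalSubspace (shortSpan g i) := by
  refine ⟨{q | (fun i => (q i : ℝ)) ∈ {z | z ∈ intVectors d ∧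
    ‖g *ᵥ z‖ < succMin d (g.mulVec '' intVectors d) i}}, ?_⟩
  rw [shortSpan]
  congr 1
  ext x
  constructor
  · rintro ⟨q, hq, rfl⟩
    exact hq
  · rintro ⟨⟨z, rfl⟩, hx⟩
    refine ⟨fun i => (z i : ℚ), ⟨⟨z, ?_⟩, ?_⟩, ?_⟩
    · simp
    · simpa using hx
    · simp

lemma finrank_shortSpan {d : ℕ} {g : Matrix (Fin d) (Fin d) ℝ} (hg : IsUnit g) {r : ℕ}
    (hr : r + 1 ≤ d) (hgap : succMin d (g.mulVec '' intVectors d) r <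
      succMin d (g.mulVec '' intVectors d) (r + 1)) :
    finrank ℝ (shortSpan g (r + 1)) = r := by
  apply le_antisymm
  · by_contra! hlt
    obtain ⟨f, hf, -, hlin⟩ := Submodule.exists_fun_fin_finrank_span_eq ℝ
      {z | z ∈ intVectors d ∧ ‖g *ᵥ z‖ < succMin d (g.mulVec '' intVectors d) (r + 1)}
    exact lt_irrefl _ (succMin_lt_of_forall_norm_lt hg (z := f ∘ Fin.castLE hlt)
      (fun j => (hf _).1) (hlin.comp _ (Fin.castLE_injective _)) fun j => (hf _).2)
  · obtain ⟨z, hz, hlin, hlt⟩ := exists_norm_lt_of_succMin_lt hg (by omega) hgap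
    have h1 := finrank_span_eq_card hlin
    rw [Fintype.card_fin] at h1
    refine h1.ge.trans (Submodule.finrank_mono ?_)
    rw [Submodule.span_le]
    rintro _ ⟨j, rfl⟩
    exact Submodule.subset_span ⟨hz j, hlt j⟩

/-- As long as the gap between consecutive minima persists, the corresponding rational subspace
does not change. -/
lemma shortSpan_eq_of_gap {d : ℕ} {G : ℝ → Matrix (Fin d) (Fin d) ℝ} (hG : ∀ t, IsUnit (G t))
    (hlip : ∀ s t x, ‖G s *ᵥ x‖ ≤ Real.exp |s - t| * ‖G t *ᵥ x‖) {r : ℕ} (hr : r + 1 ≤ d)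
    {T : ℝ} (hgap : ∀ t, T ≤ t → succMin d ((G t).mulVec '' intVectors d) r <
      succMin d ((G t).mulVec '' intVectors d) (r + 1)) {t : ℝ} (ht : T ≤ t) :
    shortSpan (G t) (r + 1) = shortSpan (G T) (r + 1) := by
  have hloc : IsLocallyConstant fun t : Set.Ici T => shortSpan (G t) (r + 1) := by
    rw [IsLocallyConstant.iff_eventually_eq]
    rintro ⟨t, ht⟩
    obtain ⟨z, hz, hlin, hlt⟩ := exists_norm_lt_of_succMin_lt (hG t) (by omega) (hgap t ht)
    have hev : ∀ᶠ s : Set.Ici T in nhds ⟨t, ht⟩, ∀ j, Real.exp |(s : ℝ) - t| *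
        (Real.exp |(s : ℝ) - t| * ‖G t *ᵥ z j‖) <
          succMin d ((G t).mulVec '' intVectors d) (r + 1) := by
      rw [Filter.eventually_all]
      intro j
      have hcont : Continuous fun s : Set.Ici T => Real.exp |(s : ℝ) - t| *
        (Real.exp |(s : ℝ) - t| * ‖G t *ᵥ z j‖) := by fun_prop
      exact hcont.continuousAt.eventually_lt continuousAt_const (by simpa using hlt j)
    filter_upwards [hev] with ⟨s, hs⟩ hlts
    have hdim : ∀ u, T ≤ u → finrank ℝ (shortSpan (G u) (r + 1)) = r := fun u hu =>
      finrank_shortSpan (hG u) hr (hgap u hu)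
    have hspan : finrank ℝ (Submodule.span ℝ (Set.range z)) = r := by
      rw [finrank_span_eq_card hlin, Fintype.card_fin]
    have h1 : Submodule.span ℝ (Set.range z) = shortSpan (G t) (r + 1) := by
      apply Submodule.eq_of_le_of_finrank_eq
      · rw [Submodule.span_le]
        rintro _ ⟨j, rfl⟩
        exact Submodule.subset_span ⟨hz j, hlt j⟩
      · rw [hspan, hdim t ht]
    have h2 : Submodule.span ℝ (Set.range z) = shortSpan (G s) (r + 1) := by
      apply Submodule.eq_of_le_of_finrank_eq
      · rw [Submodule.span_le]
        rintro _ ⟨j, rfl⟩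
        refine Submodule.subset_span ⟨hz j, ?_⟩
        have h3 := succMin_le_mul (hG t) (hG s) (Real.exp_pos _) (hlip t s) hr
        have h4 := hlts j
        rw [abs_sub_comm t s] at h3
        have h5 := mul_le_mul_of_nonneg_left (hlip s t (z j)) (Real.exp_pos |s - t|).le
        exact lt_of_mul_lt_mul_left ((h5.trans_lt h4).trans_le h3) (Real.exp_pos _).le
      · rw [hspan, hdim s hs]
    exact h2.symm.trans h1
  have : PreconnectedSpace (Set.Ici T) := Subtype.preconnectedSpace isPreconnected_Ici
  exact hloc.apply_eq_of_preconnectedSpace (⟨t, ht⟩ : Set.Ici T) ⟨T, Set.self_mem_Ici⟩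

/-- A diagonal flow expanding every `r`-set of coordinates containing `i₀` has no persistent gap
after the `r`-th minimum, unless a rational subspace of dimension `r` lies in the kernel of the
`i₀`-th row. -/
lemma exists_succMin_eq {d : ℕ} {U : Matrix (Fin d) (Fin d) ℝ} (hU : |U.det| = 1)
    {σ : Fin d → ℝ} (hσ : ∀ i, |σ i| ≤ 1) (hσ0 : ∑ i, σ i = 0) {r : ℕ} (hr : r + 1 ≤ d)
    (i₀ : Fin d) (hpos : ∀ s : Finset (Fin d), i₀ ∈ s → s.card = r → 0 < ∑ i ∈ s, σ i)
    (hW : ∀ W : Submodule ℝ (Fin d → ℝ), IsRationalSubspace W → finrank ℝ W = r →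
      ∃ w ∈ W, (U *ᵥ w) i₀ ≠ 0) (T : ℝ) :
    ∃ t, T ≤ t ∧
      succMin d (((Matrix.diagonal fun i => Real.exp (σ i * t)) * U).mulVec '' intVectors d) r =
      succMin d (((Matrix.diagonal fun i => Real.exp (σ i * t)) * U).mulVec '' intVectors d)
        (r + 1) := by
  set G : ℝ → Matrix (Fin d) (Fin d) ℝ := fun t =>
    (Matrix.diagonal fun i => Real.exp (σ i * t)) * U with hGdef
  have hdet : ∀ t, |(G t).det| = 1 := fun t => by
    rw [hGdef, Matrix.det_mul, Matrix.det_diagonal, ← Real.exp_sum, ← Finset.sum_mul, hσ0]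
    simp [hU]
  have hG : ∀ t, IsUnit (G t) := fun t => by
    rw [Matrix.isUnit_iff_isUnit_det, isUnit_iff_ne_zero, ← abs_pos, hdet]
    exact one_pos
  have hUunit : IsUnit U := by
    rw [Matrix.isUnit_iff_isUnit_det, isUnit_iff_ne_zero, ← abs_pos, hU]
    exact one_pos
  have hlip : ∀ s t x, ‖G s *ᵥ x‖ ≤ Real.exp |s - t| * ‖G t *ᵥ x‖ := by
    intro s t x
    have hentry : ∀ u i, (G u *ᵥ x) i = Real.exp (σ i * u) * (U *ᵥ x) i := fun u i => by
      rw [hGdef, ← Matrix.mulVec_mulVec, Matrix.mulVec_diagonal]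
    rw [pi_norm_le_iff_of_nonneg (by positivity)]
    intro i
    have h1 : (G s *ᵥ x) i = Real.exp (σ i * (s - t)) * (G t *ᵥ x) i := by
      rw [hentry, hentry, ← mul_assoc, ← Real.exp_add]
      ring_nf
    rw [h1, norm_mul, Real.norm_eq_abs, Real.abs_exp]
    refine mul_le_mul (Real.exp_le_exp.2 ?_) (norm_le_pi_norm _ i) (norm_nonneg _)
      (Real.exp_pos _).le
    calc σ i * (s - t) ≤ |σ i * (s - t)| := le_abs_self _
      _ = |σ i| * |s - t| := abs_mul _ _
      _ ≤ |s - t| := mul_le_of_le_one_left (abs_nonneg _) (hσ i)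
  by_contra! hne
  have hgap : ∀ t, T ≤ t → succMin d ((G t).mulVec '' intVectors d) r <
      succMin d ((G t).mulVec '' intVectors d) (r + 1) := fun t ht =>
    lt_of_le_of_ne (succMin_le_succ (hG t) hr) (hne t ht)
  set W := shortSpan (G T) (r + 1) with hWdef
  have hWr : finrank ℝ W = r := finrank_shortSpan (hG T) hr (hgap T le_rfl)
  obtain ⟨s, his, hscard, c, hc, hlower⟩ := exists_le_prod_norm hUunit σ W i₀
    (hW W (isRationalSubspace_shortSpan _ _) hWr)
  have hδ : 0 < ∑ i ∈ s, σ i := hpos s his (hscard.trans hWr)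
  have hlim : Filter.Tendsto (fun t => c * Real.exp ((∑ i ∈ s, σ i) * t))
      Filter.atTop Filter.atTop :=
    (Real.tendsto_exp_atTop.comp (Filter.tendsto_id.const_mul_atTop hδ)).const_mul_atTop hc
  obtain ⟨t, hbig, htT⟩ :=
    ((hlim.eventually_gt_atTop ((d : ℝ) ^ d)).and (Filter.eventually_ge_atTop T)).exists
  obtain ⟨v, hv, hint, hmin⟩ := exists_minimal_family (G t)
    ((Matrix.isUnit_iff_isUnit_det _).1 (hG t)).ne_zero
  have hupper := prod_norm_le_of_minimal (by omega) (G t) (hdet t) v hv hmin hint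
  have hWt : shortSpan (G t) (r + 1) = W := shortSpan_eq_of_gap hG hlip hr hgap htT
  have hvW : ∀ j : Fin d, (j : ℕ) < r → v j ∈ W := by
    intro j hj
    have hex : ∃ z, (z ∈ intVectors d ∧
        ‖G t *ᵥ z‖ < succMin d ((G t).mulVec '' intVectors d) (r + 1)) ∧
        z ∉ Submodule.span ℝ (v '' Set.Iio j) := by
      by_contra! hall
      have hle : W ≤ Submodule.span ℝ (v '' Set.Iio j) := by
        rw [← hWt, shortSpan, Submodule.span_le]
        exact hall
      have h1 := Submodule.finrank_mono hle
      have h2 : finrank ℝ (Submodule.span ℝ (v '' Set.Iio j)) ≤ j := by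
        have h3 := finrank_span_finset_le_card (R := ℝ) ((Finset.Iio j).image v)
        rw [Finset.coe_image, Finset.coe_Iio] at h3
        exact h3.trans (Finset.card_image_le.trans (by simp))
      omega
    obtain ⟨z, ⟨hz, hzlt⟩, hznot⟩ := hex
    rw [← hWt]
    exact Submodule.subset_span ⟨hint j, (hmin j z hz hznot).trans_lt hzlt⟩
  have hrd : r ≤ d := by omega
  have hprod : (d : ℝ) ^ d < ∏ b : Fin (finrank ℝ W),
      ‖G t *ᵥ v (Fin.castLE (hWr.trans_le hrd) b)‖ :=
    hbig.trans_le (hlower t (fun b => v (Fin.castLE (hWr.trans_le hrd) b))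
      (hv.comp _ (Fin.castLE_injective _)) (fun b => hvW _ (b.isLt.trans_eq hWr))
      fun b => hint _)
  have hdd : (1 : ℝ) ≤ (d : ℝ) ^ d := one_le_pow₀ (by exact_mod_cast (by omega : 1 ≤ d))
  obtain ⟨j, hj⟩ : ∃ b : Fin (finrank ℝ W),
      1 < ‖G t *ᵥ v (Fin.castLE (hWr.trans_le hrd) b)‖ := by
    by_contra! hall
    exact absurd (hdd.trans_lt hprod) (not_lt.2
      (Finset.prod_le_one (fun _ _ => norm_nonneg _) fun b _ => hall b))
  have hlarge : ∀ i : Fin d, r ≤ i → 1 ≤ ‖G t *ᵥ v i‖ := fun i hi => by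
    refine hj.le.trans (hmin _ _ (hint i) (hv.notMem_span_image ?_))
    have := j.isLt
    simp only [Set.mem_Iio, not_lt, Fin.le_def, Fin.val_castLE]
    omega
  set A : Finset (Fin d) := Finset.univ.map (Fin.castLEEmb (hWr.trans_le hrd)) with hA
  have hcompl : 1 ≤ ∏ i ∈ Aᶜ, ‖G t *ᵥ v i‖ := by
    rw [← Finset.prod_const_one (s := Aᶜ)]
    refine Finset.prod_le_prod (fun _ _ => zero_le_one) fun i hi => hlarge i ?_
    by_contra! hlt
    refine Finset.mem_compl.1 hi ?_
    rw [hA, Finset.mem_map]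
    exact ⟨⟨i, hlt.trans_eq hWr.symm⟩, Finset.mem_univ _, rfl⟩
  rw [← Finset.prod_mul_prod_compl A, hA, Finset.prod_map] at hupper
  refine absurd hupper (not_le.2 (hprod.trans_le ?_))
  exact le_mul_of_one_le_right (Finset.prod_nonneg fun _ _ => norm_nonneg _) hcompl

/-- Rank-nullity for rational relations between the entries of `η`. -/
lemma finrank_add_le_of_dotProduct_eq_zero {d m : ℕ} (η : Fin d → ℝ)
    {W : Submodule ℝ (Fin d → ℝ)} (hW : IsRationalSubspace W) (hker : ∀ w ∈ W, η ⬝ᵥ w = 0)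
    (e : Fin m → Fin d) (hind : LinearIndependent ℚ fun i => η (e i)) :
    finrank ℝ W + m ≤ d := by
  obtain ⟨S, rfl⟩ := hW
  let toReal : (Fin d → ℚ) →ₗ[ℚ] (Fin d → ℝ) := (Algebra.linearMap ℚ ℝ).compLeft (Fin d)
  obtain ⟨f, hf, -, hlin⟩ := Submodule.exists_fun_fin_finrank_span_eq ℝ
    ((fun q : Fin d → ℚ => fun i => ((q i : ℝ))) '' S)
  choose q hqS hqf using hf
  have hq : LinearIndependent ℚ q := by
    refine LinearIndependent.of_comp toReal ?_
    have hqf' : toReal ∘ q = f := funext hqf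
    rw [hqf']
    exact hlin.restrict_scalars (R := ℚ) (fun a b hab => by simpa using hab)
  let φ : (Fin d → ℚ) →ₗ[ℚ] ℝ := Fintype.linearCombination ℚ η
  have hφ : ∀ x, φ x = η ⬝ᵥ fun i => (x i : ℝ) := fun x => by
    simp [φ, Fintype.linearCombination_apply, dotProduct, Rat.smul_def, mul_comm]
  have h1 : finrank ℝ (Submodule.span ℝ ((fun q : Fin d → ℚ => fun i => ((q i : ℝ))) '' S))
      ≤ finrank ℚ (LinearMap.ker φ) := by
    have h2 := finrank_span_eq_card hq
    rw [Fintype.card_fin] at h2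
    rw [← h2]
    apply Submodule.finrank_mono
    rw [Submodule.span_le]
    rintro _ ⟨j, rfl⟩
    rw [SetLike.mem_coe, LinearMap.mem_ker, hφ]
    exact hker _ (Submodule.subset_span ⟨q j, hqS j, rfl⟩)
  have h3 : m ≤ finrank ℚ (LinearMap.range φ) := by
    have h4 := finrank_span_eq_card hind
    rw [Fintype.card_fin] at h4
    rw [← h4]
    apply Submodule.finrank_mono
    rw [Submodule.span_le]
    rintro _ ⟨j, rfl⟩
    exact ⟨Pi.single (e j) 1, by simp [φ]⟩
  have h5 := φ.finrank_range_add_finrank_ker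
  rw [finrank_fin_fun] at h5
  omega

lemma uMat_row_castAdd {n : ℕ} (x : Matrix (Fin 1) (Fin n) ℝ) :
    uMat 1 n x (Fin.castAdd n 0) (Fin.castAdd n 0) = 1 := by
  simp [uMat]

lemma uMat_row_natAdd {n : ℕ} (x : Matrix (Fin 1) (Fin n) ℝ) (j : Fin n) :
    uMat 1 n x (Fin.castAdd n 0) (Fin.natAdd 1 j) = x 0 j := by
  simp [uMat]

lemma det_uMat (m n : ℕ) (x : Matrix (Fin m) (Fin n) ℝ) : (uMat m n x).det = 1 := by
  rw [uMat, Matrix.det_reindex_self, Matrix.det_fromBlocks_zero₂₁]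
  simp

lemma exists_mulVec_ne_zero {n k : ℕ} (hk : k ≤ n) {ξ : Fin n → ℝ} (nsel : Fin k → Fin n)
    (hind : LinearIndependent ℚ (Fin.cons (1 : ℝ) (fun i => ξ (nsel i)) : Fin (k + 1) → ℝ))
    {W : Submodule ℝ (Fin (1 + n) → ℝ)} (hW : IsRationalSubspace W)
    (hdim : finrank ℝ W = 1 + n - k) :
    ∃ w ∈ W, (uMat 1 n (rowMat n ξ) *ᵥ w) (Fin.castAdd n 0) ≠ 0 := by
  by_contra! hall
  have := finrank_add_le_of_dotProduct_eq_zero (uMat 1 n (rowMat n ξ) (Fin.castAdd n 0)) hW hall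
    (Fin.cons (Fin.castAdd n 0) fun i => Fin.natAdd 1 (nsel i) : Fin (k + 1) → Fin (1 + n)) (by
      convert hind using 1
      ext i
      refine Fin.cases ?_ (fun i => ?_) i
      · rw [Fin.cons_zero, Fin.cons_zero, uMat_row_castAdd]
      · rw [Fin.cons_succ, Fin.cons_succ, uMat_row_natAdd]
        rfl)
  omega

section weights

variable {n : ℕ} {ω : Fin (1 + n) → ℝ}

lemma IsWeightVector.zero_eq_one (hω : IsWeightVector 1 n ω) : ω (Fin.castAdd n 0) = 1 := by
  rw [← hω.2.2.2.1]
  symm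
  apply Finset.sum_eq_single_of_mem
  · exact Finset.mem_filter.2 ⟨Finset.mem_univ _, Nat.zero_lt_one⟩
  · intro i hi hne
    exact absurd (Fin.ext (by simpa using hi)) hne

lemma IsWeightVector.sum_lt_one (hω : IsWeightVector 1 n ω) {A : Finset (Fin (1 + n))}
    (hA : ∀ i ∈ A, 1 ≤ (i : ℕ)) (hcard : A.card < n) : ∑ i ∈ A, ω i < 1 := by
  rw [← hω.2.2.2.2]
  have hsub : A ⊆ Finset.univ.filter fun i : Fin (1 + n) => 1 ≤ (i : ℕ) := fun i hi => by
    simpa using hA i hi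
  have hinj : n ≤ (Finset.univ.filter fun i : Fin (1 + n) => 1 ≤ (i : ℕ)).card := by
    have := Finset.card_le_card (s := Finset.univ.map (Fin.natAddEmb 1 : Fin n ↪ Fin (1 + n)))
      (t := Finset.univ.filter fun i : Fin (1 + n) => 1 ≤ (i : ℕ)) (fun i hi => by
        obtain ⟨j, -, rfl⟩ := Finset.mem_map.1 hi
        simp)
    simpa using this
  obtain ⟨i, hi, hiA⟩ := Finset.exists_of_ssubset (Finset.ssubset_iff_subset_ne.2
    ⟨hsub, fun h => by rw [h] at hcard; omega⟩)
  exact Finset.sum_lt_sum_of_subset hsub hi hiA (hω.1 i) fun j _ _ => (hω.1 j).le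

lemma IsWeightVector.sum_signedWeight (hω : IsWeightVector 1 n ω) :
    ∑ i, signedWeight 1 ω i = 0 := by
  rw [Fin.sum_univ_add]
  have h := hω.2.2.2.2
  rw [Finset.sum_filter, Fin.sum_univ_add] at h
  have h0 : ∀ j : Fin 1, (if 1 ≤ (Fin.castAdd n j : ℕ) then ω (Fin.castAdd n j) else 0) = 0 :=
    fun j => if_neg (not_le.2 j.isLt)
  have h1 : ∀ j : Fin n, (if 1 ≤ (Fin.natAdd 1 j : ℕ) then ω (Fin.natAdd 1 j) else 0) =
      ω (Fin.natAdd 1 j) := fun j => if_pos (Nat.le_add_right 1 j)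
  have h2 : signedWeight 1 ω (Fin.castAdd n 0) = 1 :=
    (if_pos Nat.zero_lt_one).trans hω.zero_eq_one
  have h3 : ∀ j : Fin n, signedWeight 1 ω (Fin.natAdd 1 j) = -ω (Fin.natAdd 1 j) := fun j =>
    if_neg (not_lt.2 (Nat.le_add_right 1 j))
  rw [Finset.sum_congr rfl fun j _ => h0 j, Finset.sum_congr rfl fun j _ => h1 j,
    Finset.sum_const_zero, zero_add] at h
  rw [Fin.sum_univ_one, h2, Finset.sum_congr rfl fun j _ => h3 j, Finset.sum_neg_distrib, h]
  norm_num

lemma IsWeightVector.abs_signedWeight_le (hω : IsWeightVector 1 n ω) (i : Fin (1 + n)) :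
    |signedWeight 1 ω i| ≤ 1 := by
  have habs : |signedWeight 1 ω i| = ω i := by
    rw [signedWeight]
    split_ifs
    · exact abs_of_pos (hω.1 i)
    · rw [abs_neg, abs_of_pos (hω.1 i)]
  rw [habs]
  by_cases hi : (i : ℕ) < 1
  · rw [← hω.2.2.2.1]
    exact Finset.single_le_sum (fun j _ => (hω.1 j).le) (Finset.mem_filter.2 ⟨Finset.mem_univ _, hi⟩)
  · rw [← hω.2.2.2.2]
    exact Finset.single_le_sum (fun j _ => (hω.1 j).le)
      (Finset.mem_filter.2 ⟨Finset.mem_univ _, not_lt.1 hi⟩)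

lemma IsWeightVector.sum_signedWeight_pos (hω : IsWeightVector 1 n ω) {s : Finset (Fin (1 + n))}
    (hs : Fin.castAdd n 0 ∈ s) (hcard : s.card ≤ n) : 0 < ∑ i ∈ s, signedWeight 1 ω i := by
  have hge : ∀ i ∈ s.erase (Fin.castAdd n 0), 1 ≤ (i : ℕ) := fun i hi => by
    have hne := Finset.ne_of_mem_erase hi
    by_contra! h
    exact hne (Fin.ext (by simpa using h))
  have hpos : 0 < s.card := Finset.card_pos.2 ⟨_, hs⟩
  have hlt := hω.sum_lt_one hge (by rw [Finset.card_erase_of_mem hs]; omega)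
  have hsum : ∑ i ∈ s.erase (Fin.castAdd n 0), signedWeight 1 ω i
      = -∑ i ∈ s.erase (Fin.castAdd n 0), ω i := by
    rw [← Finset.sum_neg_distrib]
    exact Finset.sum_congr rfl fun i hi => by
      rw [signedWeight, if_neg (not_lt.2 (hge i hi))]
  rw [← Finset.add_sum_erase _ _ hs, hsum, signedWeight, if_pos (by simp), hω.zero_eq_one]
  linarith

lemma IsWeightVector.psiF_lt_one (hω : IsWeightVector 1 n ω)
    {V : Submodule ℝ (Fin (1 + n) → ℝ)} (hV : finrank ℝ V < n) : psiF 1 ω V < 1 := by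
  have hmem : ∀ i ∈ Iset 1 V, 1 ≤ (i : ℕ) ∧ finrank ℝ ↥(V ⊓ Espan (1 + n) (i : ℕ)) <
      finrank ℝ ↥(V ⊓ Espan (1 + n) ((i : ℕ) + 1)) := fun i hi => by
    simpa [Iset] using hi
  refine hω.sum_lt_one (fun i hi => (hmem i hi).1) (lt_of_le_of_lt ?_ hV)
  have key : ∀ j : ℕ, ((Iset 1 V).filter fun i : Fin (1 + n) => (i : ℕ) < j).card ≤
      finrank ℝ ↥(V ⊓ Espan (1 + n) j) := by
    intro j
    induction j with
    | zero => simp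
    | succ j ih =>
      by_cases hj : ∃ i ∈ Iset 1 V, (i : ℕ) = j
      · obtain ⟨i, hi, rfl⟩ := hj
        have hsub : ((Iset 1 V).filter fun l : Fin (1 + n) => (l : ℕ) < (i : ℕ) + 1) ⊆
            insert i ((Iset 1 V).filter fun l : Fin (1 + n) => (l : ℕ) < (i : ℕ)) := fun l hl => by
          rw [Finset.mem_filter] at hl
          rw [Finset.mem_insert, Finset.mem_filter, Fin.ext_iff]
          have := hl.2
          by_cases h : (l : ℕ) = i
          · exact Or.inl h
          · exact Or.inr ⟨hl.1, by omega⟩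
        have h1 := (Finset.card_le_card hsub).trans (Finset.card_insert_le _ _)
        have h2 := (hmem i hi).2
        omega
      · have hsub : ((Iset 1 V).filter fun l : Fin (1 + n) => (l : ℕ) < j + 1) ⊆
            (Iset 1 V).filter fun l : Fin (1 + n) => (l : ℕ) < j := fun l hl => by
          rw [Finset.mem_filter] at hl ⊢
          have h1 : (l : ℕ) ≠ j := fun h => hj ⟨l, hl.1, h⟩
          exact ⟨hl.1, by omega⟩
        refine (Finset.card_le_card hsub).trans (ih.trans (Submodule.finrank_mono ?_))
        refine inf_le_inf_left _ (Submodule.span_mono ?_)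
        rintro _ ⟨i, hi, rfl⟩
        exact ⟨i, by omega, rfl⟩
  have h := key (1 + n)
  rw [Finset.filter_true_of_mem fun i _ => i.isLt] at h
  exact h.trans (Submodule.finrank_mono inf_le_left)

lemma IsWeightVector.phiF_eq_one (hω : IsWeightVector 1 n ω) {W' : Submodule ℝ (Fin 1 → ℝ)}
    (hW' : W' ≠ ⊥) : phiF 1 n ω W' = 1 := by
  have h1 : Eprime 1 1 = ⊥ := by
    rw [Eprime, Submodule.span_eq_bot]
    rintro _ ⟨i, hi, rfl⟩
    omega
  have h0 : Eprime 1 0 = ⊤ := by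
    rw [eq_top_iff, ← (Pi.basisFun ℝ (Fin 1)).span_eq]
    refine Submodule.span_mono ?_
    rintro _ ⟨i, rfl⟩
    exact ⟨i, Nat.zero_le _, by simp⟩
  have hJ : Jset W' = Finset.univ := by
    rw [Jset, Finset.filter_true_of_mem]
    intro j _
    obtain rfl : j = 0 := Subsingleton.elim _ _
    change finrank ℝ ↥(W' ⊓ Eprime 1 1) < finrank ℝ ↥(W' ⊓ Eprime 1 0)
    rw [h1, h0, inf_bot_eq, inf_top_eq, finrank_bot]
    exact Nat.pos_of_ne_zero fun h => hW' (Submodule.finrank_eq_zero.1 h)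
  rw [phiF, hJ, Fin.sum_univ_one, hω.zero_eq_one]

end weights

lemma rowMat_notMem_pencil {n : ℕ} {ω : Fin (1 + n) → ℝ} (hω : IsWeightVector 1 n ω)
    {ξ : Fin n → ℝ} {W : Submodule ℝ (Fin (1 + n) → ℝ)} {a b : ℝ} (hdim : finrank ℝ W ≤ n)
    (hab : b ≤ a) (hW : ∃ w ∈ W, (uMat 1 n (rowMat n ξ) *ᵥ w) (Fin.castAdd n 0) ≠ 0) :
    rowMat n ξ ∉ pencil 1 n ω W a b := by
  rintro ⟨ha, hb⟩
  obtain ⟨w, hw, hw0⟩ := hW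
  have hval : (xTil 1 n (rowMat n ξ)).mulVecLin w ≠ 0 := fun h => hw0 (congrFun h 0)
  have hφ := hω.phiF_eq_one (W' := W.map (xTil 1 n (rowMat n ξ)).mulVecLin) fun h =>
    hval ((Submodule.mem_bot ℝ).1 (h ▸ Submodule.mem_map_of_mem hw))
  have hlt : kerXtil 1 n (rowMat n ξ) ⊓ W < W :=
    lt_of_le_of_ne inf_le_right fun h => hval (inf_eq_right.1 h hw)
  have hψ := hω.psiF_lt_one ((Submodule.finrank_lt_finrank_of_lt hlt).trans_le hdim)
  linarith

lemma connectedAt_of_linearIndependent {n : ℕ} {ω : Fin (1 + n) → ℝ}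
    (hω : IsWeightVector 1 n ω) {ξ : Fin n → ℝ} {k : ℕ} (hk1 : 1 ≤ k) (hk2 : k ≤ n)
    (nsel : Fin k → Fin n)
    (hind : LinearIndependent ℚ (Fin.cons (1 : ℝ) (fun i => ξ (nsel i)) : Fin (k + 1) → ℝ)) :
    ConnectedAt 1 ω (latticeOf (uMat 1 n (rowMat n ξ))) (1 + n - k) := by
  intro T
  obtain ⟨t, ht, heq⟩ := exists_succMin_eq (U := uMat 1 n (rowMat n ξ))
    (by rw [det_uMat, abs_one]) hω.abs_signedWeight_le hω.sum_signedWeight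
    (r := 1 + n - k) (by omega) (Fin.castAdd n 0)
    (fun s hs hcard => hω.sum_signedWeight_pos hs (by omega))
    (fun W hW hdim => exists_mulVec_ne_zero hk2 nsel hind hW hdim) (max T 0)
  refine ⟨t, (le_max_right _ _).trans ht, (le_max_left _ _).trans ht, ?_⟩
  have himg : (aMat 1 ω t).mulVec '' latticeOf (uMat 1 n (rowMat n ξ)) =
      ((Matrix.diagonal fun i => Real.exp (signedWeight 1 ω i * t)) *
        uMat 1 n (rowMat n ξ)).mulVec '' intVectors (1 + n) := by
    rw [latticeOf, Set.image_image]
    simp only [Matrix.mulVec_mulVec]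
    rfl
  rw [Lfun, Lfun, himg, heq]

theorem connectedness_linear_forms
    (n : ℕ) (hn : 1 ≤ n)
    (ω : Fin (1 + n) → ℝ) (hω : IsWeightVector 1 n ω)
    (ξ : Fin n → ℝ) (k : ℕ) (hk1 : 1 ≤ k) (hk2 : k ≤ n)
    (nsel : Fin k → Fin n)
    (hind : LinearIndependent ℚ (Fin.cons (1 : ℝ) (fun i => ξ (nsel i)) : Fin (k + 1) → ℝ)) :
    (∀ (W : Submodule ℝ (Fin (1 + n) → ℝ)) (a b : ℝ),
        Module.finrank ℝ W = 1 + n - k → IsRationalSubspace W → b ≤ a →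
        pencil 1 n ω W a b ≠ Set.univ →
        rowMat n ξ ∉ pencil 1 n ω W a b) ∧
      ConnectedAt 1 ω (latticeOf (uMat 1 n (rowMat n ξ))) (1 + n - k) ∧
      (LinearIndependent ℚ (Fin.cons (1 : ℝ) ξ : Fin (n + 1) → ℝ) →
        ∀ k' : ℕ, 1 ≤ k' → k' ≤ n →
          ConnectedAt 1 ω (latticeOf (uMat 1 n (rowMat n ξ))) k') := by
  refine ⟨fun W a b hdim hW hab _ => rowMat_notMem_pencil hω (by omega) hab
    (exists_mulVec_ne_zero hk2 nsel hind hW hdim),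
    connectedAt_of_linearIndependent hω hk1 hk2 nsel hind, fun hall k' hk1' hk2' => ?_⟩
  have hle : 1 + n - k' ≤ n := by omega
  have h := connectedAt_of_linearIndependent hω (k := 1 + n - k') (by omega) hle
    (Fin.castLE hle) (ξ := ξ) (by
      convert hall.comp (Fin.castLE (Nat.succ_le_succ hle)) (Fin.castLE_injective _) using 1
      ext i
      refine Fin.cases ?_ (fun i => ?_) i
      · rfl
      · rfl)
  rwa [show 1 + n - (1 + n - k') = k' by omega] at h

end
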